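/- arXiv:1706.03390 — 2 statements merged into one kernel-verified Lean document; each statement's English description precedes it below -/
import Mathlib

section
/- For every ε > 0, the probability that Q^n(1) contains a connected component with at least ε·2^n vertices tends to 0 as n → ∞ (i.e. w.h.p. Q^n(1) has no component spanning Ω(2^n) vertices). -/
open scoped Classical
open Filter

noncomputable section

/-- The vertex set of the `n`-dimensional hypercube: `{0,1}^n`. -/
abbrev Vtx (n : ℕ) := Fin n → Bool

/-- The `n`-dimensional hypercube graph `Q^n`: two vertices are adjacent iff they
differ in exactly one coordinate. -/
def cubeGraph (n : ℕ) : SimpleGraph (Vtx n) :=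
  SimpleGraph.fromRel (fun u v => hammingDist u v = 1)

/-- Sample space for the `k`-out model on `Q^n`: each vertex `v` chooses a
`k`-element set of its neighbours (equivalently, `k` incident edges). -/
abbrev KOut (n k : ℕ) :=
  ∀ v : Vtx n, {s : Finset (Vtx n) // s.card = k ∧ ∀ u ∈ s, (cubeGraph n).Adj v u}

/-- The random subgraph `Q^n(k)` produced by an outcome of the `k`-out model:
`u` and `v` are adjacent iff one of them chose the edge between them. -/
def kOutGraph (n k : ℕ) (ω : KOut n k) : SimpleGraph (Vtx n) :=
  SimpleGraph.fromRel (fun u v => v ∈ (ω u).1)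

/-- Uniform (counting) probability of an event on a finite sample space. -/
def prob {Ω : Type*} [Finite Ω] (p : Ω → Prop) : ℝ :=
  (Nat.card {ω : Ω // p ω} : ℝ) / (Nat.card Ω : ℝ)

/-- Number of vertices in the connected component of `v` in `G`. -/
def compSize {V : Type*} (G : SimpleGraph V) (v : V) : ℕ :=
  Nat.card {w : V // G.Reachable v w}

/-- The neighbour of `v` in the cube obtained by flipping coordinate `i`. -/
def flipAt {n : ℕ} (v : Vtx n) (i : Fin n) : Vtx n := Function.update v i (!(v i))

theorem flipAt_flipAt {n : ℕ} (v : Vtx n) (i : Fin n) : flipAt (flipAt v i) i = v := by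
  simp [flipAt]

theorem flipAt_ne {n : ℕ} (v : Vtx n) (i : Fin n) : flipAt v i ≠ v := by
  intro h
  have := congrFun h i
  simp [flipAt] at this

theorem flipAt_injective {n : ℕ} (v : Vtx n) : Function.Injective (flipAt v) := by
  intro i j h
  by_contra hij
  have := congrFun h i
  simp [flipAt, Function.update_of_ne hij] at this

theorem hammingDist_flipAt {n : ℕ} (v : Vtx n) (i : Fin n) : hammingDist v (flipAt v i) = 1 := by
  rw [hammingDist, Finset.card_eq_one]
  refine ⟨i, ?_⟩
  ext j
  rw [Finset.mem_filter, Finset.mem_singleton]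
  by_cases h : j = i
  · subst h; simp [flipAt]
  · simp [flipAt, h]

theorem exists_flipAt_of_hammingDist {n : ℕ} {v w : Vtx n} (h : hammingDist v w = 1) :
    ∃ i, flipAt v i = w := by
  rw [hammingDist, Finset.card_eq_one] at h
  obtain ⟨i, hi⟩ := h
  refine ⟨i, ?_⟩
  ext1 j
  have hj : v j ≠ w j ↔ j = i := by
    simpa using Finset.ext_iff.mp hi j
  by_cases h : j = i
  · subst h
    have := hj.2 rfl
    cases hv : v j <;> cases hw : w j <;> simp_all [flipAt]
  · have := not_not.mp (mt hj.1 h)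
    simp [flipAt, h, this]

theorem cubeGraph_adj_iff {n : ℕ} {v w : Vtx n} : (cubeGraph n).Adj v w ↔ ∃ i, flipAt v i = w := by
  simp only [cubeGraph, SimpleGraph.fromRel_adj, hammingDist_comm w v, or_self]
  constructor
  · exact fun h => exists_flipAt_of_hammingDist h.2
  · rintro ⟨i, rfl⟩
    exact ⟨(flipAt_ne v i).symm, hammingDist_flipAt v i⟩

/-- A choice of one direction at every vertex, i.e. an outcome of the `1`-out model. -/
abbrev Dir (n : ℕ) := Vtx n → Fin n

/-- Outcomes of the `1`-out model correspond to choices of directions. -/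
def dirEquiv (n : ℕ) : Dir n ≃ KOut n 1 :=
  Equiv.piCongrRight fun v => Equiv.ofBijective
    (fun i => ⟨{flipAt v i}, by simp, by simp [cubeGraph_adj_iff]⟩) (by
      constructor
      · intro i j h
        exact flipAt_injective v (by simpa using h)
      · rintro ⟨s, hs, hadj⟩
        obtain ⟨w, rfl⟩ := Finset.card_eq_one.mp hs
        obtain ⟨i, hi⟩ := cubeGraph_adj_iff.mp (hadj w (by simp))
        exact ⟨i, by simp [hi]⟩)

theorem coe_dirEquiv_apply {n : ℕ} (c : Dir n) (v : Vtx n) :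
    (dirEquiv n c v).1 = {flipAt v (c v)} := rfl

/-- The vertex reached from `v` after `k` steps along the chosen directions. -/
def orb {n : ℕ} (c : Dir n) (v : Vtx n) : ℕ → Vtx n
  | 0 => v
  | k + 1 => flipAt (orb c v k) (c (orb c v k))

theorem orb_add {n : ℕ} (c : Dir n) (v : Vtx n) (a b : ℕ) :
    orb c v (a + b) = orb c (orb c v a) b := by
  induction b with
  | zero => rfl
  | succ b ih => rw [← Nat.add_assoc, orb, ih, orb]

theorem orb_add_congr {n : ℕ} {c : Dir n} {u v : Vtx n} {a b : ℕ} (h : orb c u a = orb c v b)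
    (k : ℕ) : orb c u (a + k) = orb c v (b + k) := by
  rw [orb_add, orb_add, h]

theorem orb_congr {n : ℕ} {c c' : Dir n} {v : Vtx n} {m : ℕ}
    (h : ∀ k < m, c' (orb c v k) = c (orb c v k)) : ∀ k ≤ m, orb c' v k = orb c v k := by
  intro k
  induction k with
  | zero => intro _; rfl
  | succ k ih =>
    intro hk
    rw [orb, orb, ih (by omega), h k hk]

/-- The orbits of `u` and `v` meet. -/
def Meet {n : ℕ} (c : Dir n) (u v : Vtx n) : Prop := ∃ i j, orb c u i = orb c v j

theorem Meet.trans {n : ℕ} {c : Dir n} {u v w : Vtx n} (h : Meet c u v) (h' : Meet c v w) :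
    Meet c u w := by
  obtain ⟨i, j, h⟩ := h
  obtain ⟨k, l, h'⟩ := h'
  refine ⟨i + k, l + j, ?_⟩
  rw [orb_add_congr h, Nat.add_comm j k, orb_add_congr h']

theorem meet_of_reachable {n : ℕ} {c : Dir n} {u v : Vtx n}
    (h : (kOutGraph n 1 (dirEquiv n c)).Reachable u v) : Meet c u v := by
  rw [SimpleGraph.reachable_iff_reflTransGen] at h
  induction h with
  | refl => exact ⟨0, 0, rfl⟩
  | tail _ hadj ih =>
    refine ih.trans ?_
    simp only [kOutGraph, SimpleGraph.fromRel_adj, coe_dirEquiv_apply,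
      Finset.mem_singleton] at hadj
    rcases hadj.2 with h | h
    · exact ⟨1, 0, h.symm⟩
    · exact ⟨0, 1, h⟩

/-- The first `k` steps from `v` visit distinct vertices. -/
def SelfAvoiding {n : ℕ} (c : Dir n) (v : Vtx n) (k : ℕ) : Prop :=
  ∀ a ≤ k, ∀ b ≤ k, orb c v a = orb c v b → a = b

theorem exists_orb_eq_lt {n : ℕ} {c : Dir n} {v : Vtx n} {T : ℕ} (h : ¬ SelfAvoiding c v T)
    (k : ℕ) : ∃ l < T, orb c v l = orb c v k := by
  obtain ⟨a, b, hab, hb, he⟩ : ∃ a b, a < b ∧ b ≤ T ∧ orb c v a = orb c v b := by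
    simp only [SelfAvoiding, not_forall] at h
    obtain ⟨a, ha, b, hb, he, hne⟩ := h
    rcases lt_or_gt_of_ne hne with h | h
    · exact ⟨a, b, h, hb, he⟩
    · exact ⟨b, a, h, ha, he.symm⟩
  induction k using Nat.strong_induction_on with
  | _ k ih =>
    by_cases hk : k < T
    · exact ⟨k, hk, rfl⟩
    · obtain ⟨l, hl, hle⟩ := ih (a + (k - b)) (by omega)
      refine ⟨l, hl, hle.trans ?_⟩
      rw [orb_add_congr he]
      congr 1
      omega

/-- The orbits of `u` and `v` run along disjoint simple paths until they meet, after `i` and `j`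
steps respectively. -/
def FirstMeet {n : ℕ} (c : Dir n) (u v : Vtx n) (i j : ℕ) : Prop :=
  orb c u i = orb c v j ∧ SelfAvoiding c u i ∧ SelfAvoiding c v j ∧
    ∀ a ≤ i, ∀ b ≤ j, orb c u a = orb c v b → a = i ∧ b = j

theorem exists_firstMeet {n : ℕ} {c : Dir n} {u v : Vtx n} {T : ℕ} (h : Meet c u v)
    (hu : ¬ SelfAvoiding c u T) (hv : ¬ SelfAvoiding c v T) :
    ∃ i < T, ∃ j < T, FirstMeet c u v i j := by
  have hex : ∃ s, ∃ i j, i < T ∧ j < T ∧ i + j = s ∧ orb c u i = orb c v j := by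
    obtain ⟨i, j, h⟩ := h
    obtain ⟨i', hi, hi'⟩ := exists_orb_eq_lt hu i
    obtain ⟨j', hj, hj'⟩ := exists_orb_eq_lt hv j
    exact ⟨_, i', j', hi, hj, rfl, by rw [hi', hj', h]⟩
  obtain ⟨i, j, hi, hj, hs, he⟩ := Nat.find_spec hex
  have hmin : ∀ a b, a < T → b < T → orb c u a = orb c v b → i + j ≤ a + b := by
    intro a b ha hb hab
    rw [hs]
    exact Nat.find_min' hex ⟨a, b, ha, hb, rfl, hab⟩
  have hu' : ∀ a b, a < b → b ≤ i → orb c u a ≠ orb c u b := by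
    intro a b hab hb h
    have h1 := orb_add_congr h (i - b)
    rw [show b + (i - b) = i by omega, he] at h1
    have := hmin _ _ (by omega) hj h1
    omega
  have hv' : ∀ a b, a < b → b ≤ j → orb c v a ≠ orb c v b := by
    intro a b hab hb h
    have h1 := orb_add_congr h (j - b)
    rw [show b + (j - b) = j by omega, ← he] at h1
    have := hmin _ _ hi (by omega) h1.symm
    omega
  refine ⟨i, hi, j, hj, he, ?_, ?_, ?_⟩
  · intro a ha b hb h
    by_contra hne
    rcases lt_or_gt_of_ne hne with hlt | hlt
    · exact hu' a b hlt hb h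
    · exact hu' b a hlt ha h.symm
  · intro a ha b hb h
    by_contra hne
    rcases lt_or_gt_of_ne hne with hlt | hlt
    · exact hv' a b hlt hb h
    · exact hv' b a hlt ha h.symm
  · intro a ha b hb h
    have := hmin a b (by omega) (by omega) h
    omega

/-- Reversing the last edge on the way from `v` to the meeting point moves the meeting point
one step towards `v`. -/
theorem FirstMeet.swap {n : ℕ} {c : Dir n} {u v : Vtx n} {i j : ℕ} (h : FirstMeet c u v i (j + 1)) :
    let c' : Dir n := c ∘ Equiv.swap (orb c u i) (orb c v j)
    FirstMeet c' u v (i + 1) j ∧ orb c' u i = orb c u i ∧ orb c' v j = orb c v j := by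
  intro c'
  obtain ⟨he, hu, hv, hm⟩ := h
  have h1 : ∀ a ≤ i, orb c' u a = orb c u a := by
    refine orb_congr fun a ha => ?_
    simp only [c', Function.comp]
    rw [Equiv.swap_apply_of_ne_of_ne]
    · intro h
      have := hu a ha.le i le_rfl h
      omega
    · intro h
      have := hm a ha.le j (by omega) h
      omega
  have h2 : ∀ b ≤ j, orb c' v b = orb c v b := by
    refine orb_congr fun b hb => ?_
    simp only [c', Function.comp]
    rw [Equiv.swap_apply_of_ne_of_ne]
    · intro h
      have := hm i le_rfl b (by omega) h.symm
      omega
    · intro h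
      have := hv b (by omega) j (by omega) h
      omega
  have h3 : orb c' u (i + 1) = orb c v j := by
    rw [orb, h1 i le_rfl]
    simp only [c', Function.comp, Equiv.swap_apply_left]
    rw [he, orb, flipAt_flipAt]
  refine ⟨⟨?_, ?_, ?_, ?_⟩, h1 i le_rfl, h2 j le_rfl⟩
  · rw [h3, h2 j le_rfl]
  · intro a ha b hb h
    rcases Nat.lt_or_ge i a with ha' | ha' <;> rcases Nat.lt_or_ge i b with hb' | hb'
    · omega
    · obtain rfl : a = i + 1 := by omega
      rw [h3, h1 b hb'] at h
      have := hm b hb' j (by omega) h.symm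
      omega
    · obtain rfl : b = i + 1 := by omega
      rw [h3, h1 a ha'] at h
      have := hm a ha' j (by omega) h
      omega
    · rw [h1 a ha', h1 b hb'] at h
      exact hu a ha' b hb' h
  · intro a ha b hb h
    rw [h2 a ha, h2 b hb] at h
    exact hv a (by omega) b (by omega) h
  · intro a ha b hb h
    rw [h2 b hb] at h
    rcases Nat.lt_or_ge i a with ha' | ha'
    · obtain rfl : a = i + 1 := by omega
      rw [h3] at h
      have := hv j (by omega) b (by omega) h
      omega
    · rw [h1 a ha'] at h
      have := hm a ha' b (by omega) h
      omega

theorem card_firstMeet_le {n : ℕ} (u : Vtx n) (i j : ℕ) :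
    (Finset.univ.filter fun p : Vtx n × Dir n => FirstMeet p.2 u p.1 i j).card ≤
      Fintype.card (Dir n) := by
  induction j generalizing i with
  | zero =>
    refine Finset.card_le_card_of_injOn Prod.snd (fun _ _ => Finset.mem_univ _) ?_
    rintro ⟨v, c⟩ hp ⟨w, d⟩ hq h
    simp only [Finset.coe_filter, Finset.mem_univ, true_and, Set.mem_ofPred_eq] at hp hq
    obtain rfl : c = d := h
    exact Prod.ext (hp.1.symm.trans hq.1) rfl
  | succ j ih =>
    refine le_trans ?_ (ih (i + 1))
    refine Finset.card_le_card_of_injOn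
      (fun p => (p.1, p.2 ∘ Equiv.swap (orb p.2 u i) (orb p.2 p.1 j))) ?_ ?_
    · rintro ⟨v, c⟩ hp
      simp only [Finset.coe_filter, Finset.mem_univ, true_and, Set.mem_ofPred_eq] at hp ⊢
      exact hp.swap.1
    · rintro ⟨v, c⟩ hp ⟨w, d⟩ hq h
      simp only [Finset.coe_filter, Finset.mem_univ, true_and, Set.mem_ofPred_eq] at hp hq
      simp only [Prod.mk.injEq] at h
      obtain ⟨rfl, h⟩ := h
      have hc := hp.swap.2
      have hd := hq.swap.2
      rw [← h] at hd
      have e1 := hc.1.symm.trans hd.1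
      have e2 := hc.2.symm.trans hd.2
      rw [← e1, ← e2] at h
      exact Prod.ext rfl ((Equiv.swap (orb c u i) (orb c v j)).surjective.injective_comp_right h)

theorem SelfAvoiding.mono {n : ℕ} {c : Dir n} {v : Vtx n} {k l : ℕ} (h : SelfAvoiding c v l)
    (hkl : k ≤ l) : SelfAvoiding c v k :=
  fun a ha b hb => h a (ha.trans hkl) b (hb.trans hkl)

theorem SelfAvoiding.orb_update {n : ℕ} {c : Dir n} {v : Vtx n} {k : ℕ} (h : SelfAvoiding c v k)
    (i : Fin n) : ∀ a ≤ k, orb (Function.update c (orb c v k) i) v a = orb c v a := by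
  refine orb_congr fun a ha => Function.update_of_ne (fun he => ?_) _ _
  have := h a ha.le k le_rfl he
  omega

theorem card_selfAvoiding_le_mul_card_backtrack {n : ℕ} (v : Vtx n) (k : ℕ) :
    (Finset.univ.filter fun c : Dir n => SelfAvoiding c v (k + 1)).card ≤
      (Finset.univ.filter fun c : Dir n =>
        SelfAvoiding c v (k + 1) ∧ c (orb c v (k + 1)) = c (orb c v k)).card * n := by
  have hprod := Finset.card_product (Finset.univ.filter fun c : Dir n =>
    SelfAvoiding c v (k + 1) ∧ c (orb c v (k + 1)) = c (orb c v k))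
    (Finset.univ : Finset (Fin n))
  rw [Finset.card_fin] at hprod
  rw [← hprod]
  refine Finset.card_le_card_of_injOn
    (fun c => (Function.update c (orb c v (k + 1)) (c (orb c v k)), c (orb c v (k + 1)))) ?_ ?_
  · intro c hc
    simp only [Finset.coe_filter, Finset.mem_univ, true_and, Set.mem_ofPred_eq,
      Finset.mem_coe, Finset.mem_product, Finset.mem_filter, and_true] at hc ⊢
    have ho := hc.orb_update (c (orb c v k))
    refine ⟨fun a ha b hb h => hc a ha b hb ?_, ?_⟩
    · rwa [ho a ha, ho b hb] at h
    · rw [ho (k + 1) le_rfl, ho k (by omega), Function.update_self, Function.update_of_ne]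
      intro h
      have := hc k (by omega) (k + 1) le_rfl h
      omega
  · intro c hc d hd h
    simp only [Finset.coe_filter, Finset.mem_univ, true_and, Set.mem_ofPred_eq] at hc hd
    simp only [Prod.mk.injEq] at h
    obtain ⟨h, hv⟩ := h
    have e1 := hc.orb_update (c (orb c v k)) (k + 1) le_rfl
    have e2 := hd.orb_update (d (orb d v k)) (k + 1) le_rfl
    rw [← h] at e2
    have e := e1.symm.trans e2
    rw [← e] at h hv
    ext1 x
    by_cases hx : x = orb c v (k + 1)
    · rw [hx, hv]
    · have := congrFun h x
      rwa [Function.update_of_ne hx, Function.update_of_ne hx] at this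

theorem card_selfAvoiding_succ_add_le {n : ℕ} (v : Vtx n) (k : ℕ) :
    (Finset.univ.filter fun c : Dir n => SelfAvoiding c v (k + 2)).card +
      (Finset.univ.filter fun c : Dir n =>
        SelfAvoiding c v (k + 1) ∧ c (orb c v (k + 1)) = c (orb c v k)).card ≤
      (Finset.univ.filter fun c : Dir n => SelfAvoiding c v (k + 1)).card := by
  rw [← Finset.card_union_of_disjoint]
  · refine Finset.card_le_card fun c hc => ?_
    simp only [Finset.mem_union, Finset.mem_filter, Finset.mem_univ, true_and] at hc ⊢
    exact hc.elim (fun h => h.mono (by omega)) And.left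
  · rw [Finset.disjoint_filter]
    rintro c - h ⟨-, h'⟩
    have : orb c v (k + 2) = orb c v k := by
      rw [orb, h', orb, flipAt_flipAt]
    have := h _ le_rfl k (by omega) this
    omega

theorem card_selfAvoiding_le {n : ℕ} (hn : 0 < n) (v : Vtx n) (k : ℕ) :
    ((Finset.univ.filter fun c : Dir n => SelfAvoiding c v (k + 1)).card : ℝ) ≤
      (1 - 1 / n) ^ k * Fintype.card (Dir n) := by
  have hn1 : (1 : ℝ) ≤ n := by exact_mod_cast hn
  induction k with
  | zero =>
    rw [pow_zero, one_mul]
    exact_mod_cast Finset.card_le_univ _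
  | succ k ih =>
    have h1 : ((_ : ℕ) : ℝ) ≤ _ := Nat.cast_le.mpr (card_selfAvoiding_le_mul_card_backtrack v k)
    have h2 : ((_ : ℕ) : ℝ) ≤ _ := Nat.cast_le.mpr (card_selfAvoiding_succ_add_le v k)
    push_cast at h1 h2
    rw [← div_le_iff₀ (by positivity)] at h1
    have h3 : (0 : ℝ) ≤ 1 - 1 / n := by
      rw [sub_nonneg, div_le_one (by positivity)]; exact hn1
    calc _ ≤ (1 - 1 / (n : ℝ)) *
          ((Finset.univ.filter fun c : Dir n => SelfAvoiding c v (k + 1)).card : ℝ) := by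
          rw [sub_mul, one_mul, one_div_mul_eq_div]; linarith
      _ ≤ _ := by
          rw [pow_succ', mul_assoc]
          exact mul_le_mul_of_nonneg_left ih h3

theorem sum_card_meet_le {n : ℕ} (u : Vtx n) (T : ℕ) (B : ℝ)
    (hB : ∀ v : Vtx n,
      ((Finset.univ.filter fun c : Dir n => SelfAvoiding c v T).card : ℝ) ≤ B) :
    ∑ v : Vtx n, ((Finset.univ.filter fun c : Dir n => Meet c u v).card : ℝ) ≤
      2 ^ n * (2 * B) + T ^ 2 * Fintype.card (Dir n) := by
  have hpt : ∀ v : Vtx n, ((Finset.univ.filter fun c : Dir n => Meet c u v).card : ℝ) ≤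
      2 * B + ∑ i ∈ Finset.range T, ∑ j ∈ Finset.range T,
        ((Finset.univ.filter fun c : Dir n => FirstMeet c u v i j).card : ℝ) := by
    intro v
    have hsub : (Finset.univ.filter fun c : Dir n => Meet c u v) ⊆
        ((Finset.univ.filter fun c : Dir n => SelfAvoiding c u T) ∪
          (Finset.univ.filter fun c : Dir n => SelfAvoiding c v T)) ∪
        (Finset.range T).biUnion fun i => (Finset.range T).biUnion fun j =>
          Finset.univ.filter fun c : Dir n => FirstMeet c u v i j := by
      intro c hc
      simp only [Finset.mem_union, Finset.mem_biUnion, Finset.mem_filter, Finset.mem_univ,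
        true_and, Finset.mem_range] at hc ⊢
      by_cases hu : SelfAvoiding c u T
      · exact Or.inl (Or.inl hu)
      by_cases hv : SelfAvoiding c v T
      · exact Or.inl (Or.inr hv)
      · exact Or.inr (exists_firstMeet hc hu hv)
    have hcard := (Finset.card_le_card hsub).trans <| (Finset.card_union_le _ _).trans <|
      add_le_add (Finset.card_union_le _ _) <| Finset.card_biUnion_le.trans <|
        Finset.sum_le_sum fun i _ => Finset.card_biUnion_le
    have hcast : ((_ : ℕ) : ℝ) ≤ _ := Nat.cast_le.mpr hcard
    push_cast at hcast
    linarith [hB u, hB v]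
  have hsum : ∀ i j, ∑ v : Vtx n,
      ((Finset.univ.filter fun c : Dir n => FirstMeet c u v i j).card : ℝ) ≤
        Fintype.card (Dir n) := by
    intro i j
    rw [← Nat.cast_sum, Nat.cast_le]
    refine le_trans (le_of_eq ?_) (card_firstMeet_le u i j)
    simp only [Finset.card_filter, Fintype.sum_prod_type]
  calc _ ≤ _ := Finset.sum_le_sum fun v _ => hpt v
    _ = 2 ^ n * (2 * B) + ∑ i ∈ Finset.range T, ∑ j ∈ Finset.range T, ∑ v : Vtx n,
        ((Finset.univ.filter fun c : Dir n => FirstMeet c u v i j).card : ℝ) := by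
      rw [Finset.sum_add_distrib, Finset.sum_comm]
      congr 1
      · simp
      · exact Finset.sum_congr rfl fun i _ => Finset.sum_comm
    _ ≤ 2 ^ n * (2 * B) + ∑ i ∈ Finset.range T, ∑ j ∈ Finset.range T,
        (Fintype.card (Dir n) : ℝ) := by
      gcongr with i _ j _
      exact hsum i j
    _ = _ := by
      simp only [Finset.sum_const, Finset.card_range, nsmul_eq_mul]
      ring

theorem sq_compSize_le_card_meet {n : ℕ} (c : Dir n) (v : Vtx n) :
    compSize (kOutGraph n 1 (dirEquiv n c)) v ^ 2 ≤
      (Finset.univ.filter fun p : Vtx n × Vtx n => Meet c p.1 p.2).card := by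
  rw [compSize, Nat.card_eq_fintype_card, Fintype.card_subtype, sq, ← Finset.card_product]
  refine Finset.card_le_card fun p hp => ?_
  simp only [Finset.mem_product, Finset.mem_filter, Finset.mem_univ, true_and] at hp ⊢
  exact meet_of_reachable (hp.1.symm.trans hp.2)

theorem prob_large_component_le {n : ℕ} (hn : 0 < n) {ε : ℝ} (hε : 0 < ε) (k : ℕ) :
    prob (fun ω : KOut n 1 =>
      ∃ v : Vtx n, ε * 2 ^ n ≤ (compSize (kOutGraph n 1 ω) v : ℝ)) ≤
      (2 * (1 - 1 / n) ^ k + (k + 1) ^ 2 / 2 ^ n) / ε ^ 2 := by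
  set p : KOut n 1 → Prop := fun ω =>
    ∃ v : Vtx n, ε * 2 ^ n ≤ (compSize (kOutGraph n 1 ω) v : ℝ)
  set E := Finset.univ.filter fun c : Dir n => p (dirEquiv n c)
  have hprob : prob p = (E.card : ℝ) / Fintype.card (Dir n) := by
    rw [prob, ← Nat.card_congr (dirEquiv n), Nat.card_eq_fintype_card (α := Dir n),
      ← Nat.card_congr ((dirEquiv n).subtypeEquiv (p := fun c => p (dirEquiv n c))
        fun _ => Iff.rfl), Nat.card_eq_fintype_card, Fintype.card_subtype]
  have : Nonempty (Fin n) := ⟨⟨0, hn⟩⟩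
  have hΩ : (0 : ℝ) < Fintype.card (Dir n) := by exact_mod_cast Fintype.card_pos
  have hlow : E.card * (ε * 2 ^ n) ^ 2 ≤
      ∑ c : Dir n, ((Finset.univ.filter fun q : Vtx n × Vtx n => Meet c q.1 q.2).card : ℝ) := by
    rw [← nsmul_eq_mul]
    refine (Finset.card_nsmul_le_sum E _ _ fun c hc => ?_).trans
      (Finset.sum_le_univ_sum_of_nonneg fun _ => Nat.cast_nonneg _)
    obtain ⟨v, hv⟩ := (Finset.mem_filter.mp hc).2
    calc (ε * 2 ^ n) ^ 2 ≤ (compSize (kOutGraph n 1 (dirEquiv n c)) v : ℝ) ^ 2 := by gcongr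
      _ ≤ _ := by exact_mod_cast sq_compSize_le_card_meet c v
  have hswap : ∑ c : Dir n,
      ((Finset.univ.filter fun q : Vtx n × Vtx n => Meet c q.1 q.2).card : ℝ) =
      ∑ u : Vtx n, ∑ v : Vtx n,
        ((Finset.univ.filter fun c : Dir n => Meet c u v).card : ℝ) := by
    simp only [Finset.card_filter, Nat.cast_sum]
    rw [Finset.sum_comm, Fintype.sum_prod_type]
  have hup := Finset.sum_le_sum fun (u : Vtx n) (_ : u ∈ Finset.univ) =>
    sum_card_meet_le u (k + 1) _ fun v => card_selfAvoiding_le hn v k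
  rw [Finset.sum_const, Finset.card_univ, Fintype.card_pi, Finset.prod_const, Fintype.card_bool,
    Finset.card_univ, Fintype.card_fin, nsmul_eq_mul] at hup
  have h := hlow.trans (hswap.le.trans hup)
  push_cast at h
  rw [hprob, div_le_div_iff₀ hΩ (by positivity)]
  have hN : (0 : ℝ) < 2 ^ n := by positivity
  refine le_of_mul_le_mul_right ?_ (pow_pos hN 2)
  calc _ = E.card * (ε * 2 ^ n) ^ 2 := by ring
    _ ≤ _ := h
    _ = _ := by field_simp

theorem tendsto_one_sub_inv_pow_sq :
    Tendsto (fun n : ℕ => (1 - 1 / (n : ℝ)) ^ n ^ 2) atTop (nhds 0) := by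
  have h0 : Tendsto (fun n : ℕ => Real.exp (-(n : ℝ))) atTop (nhds 0) :=
    Real.tendsto_exp_neg_atTop_nhds_zero.comp tendsto_natCast_atTop_atTop
  have hnn : ∀ᶠ n : ℕ in atTop, 0 ≤ 1 - 1 / (n : ℝ) ∧ 0 < n := by
    filter_upwards [eventually_gt_atTop 0] with n hn
    refine ⟨?_, hn⟩
    rw [sub_nonneg, div_le_one (by positivity)]
    exact_mod_cast hn
  refine squeeze_zero' (hnn.mono fun n h => pow_nonneg h.1 _) (hnn.mono fun n h => ?_) h0
  have hn : (n : ℝ) ≠ 0 := by exact_mod_cast h.2.ne'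
  calc (1 - 1 / (n : ℝ)) ^ n ^ 2 ≤ Real.exp (-(1 / (n : ℝ))) ^ n ^ 2 :=
        pow_le_pow_left₀ h.1 (Real.one_sub_le_exp_neg _) _
    _ = Real.exp (-(n : ℝ)) := by
        rw [← Real.exp_nat_mul]
        congr 1
        push_cast
        field_simp

theorem tendsto_sq_add_one_sq_div_two_pow :
    Tendsto (fun n : ℕ => (((n ^ 2 : ℕ) : ℝ) + 1) ^ 2 / 2 ^ n) atTop (nhds 0) := by
  have h := fun k => tendsto_pow_const_div_const_pow_of_one_lt k (one_lt_two (α := ℝ))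
  have := ((h 4).add ((h 2).const_mul 2)).add (h 0)
  simp only [mul_zero, add_zero] at this
  refine this.congr fun n => ?_
  push_cast
  ring

/-- For every `ε > 0`, the probability that `Q^n(1)` contains a connected component
with at least `ε·2^n` vertices tends to `0` as `n → ∞`. -/
theorem stmt_0 (ε : ℝ) (hε : 0 < ε) :
    Tendsto (fun n : ℕ =>
        prob (fun ω : KOut n 1 =>
          ∃ v : Vtx n, ε * 2 ^ n ≤ (compSize (kOutGraph n 1 ω) v : ℝ)))
      atTop (nhds 0) := by
  have hlim := ((tendsto_one_sub_inv_pow_sq.const_mul 2).add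
    tendsto_sq_add_one_sq_div_two_pow).div_const (ε ^ 2)
  simp only [mul_zero, add_zero, zero_div] at hlim
  refine squeeze_zero' (Eventually.of_forall fun n => ?_) ?_ hlim
  · exact div_nonneg (Nat.cast_nonneg _) (Nat.cast_nonneg _)
  · filter_upwards [eventually_gt_atTop 0] with n hn
    exact prob_large_component_le hn hε (n ^ 2)
end
end

section
/- W.h.p. every connected component of Q^n(1) has at most n³·2^{n/2} vertices. -/
open scoped Classical
open Filter

noncomputable section

open Finset in
/-- The number of neighbours of a vertex of `Q^n` is `n`. -/
lemma card_filter_cubeGraph_adj (n : ℕ) (v : Vtx n) :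
    #{u | (cubeGraph n).Adj v u} = n := by
  have h : ({u | (cubeGraph n).Adj v u} : Finset (Vtx n)) =
      univ.image (fun i => Function.update v i (!v i)) := by
    ext u
    simp only [cubeGraph, SimpleGraph.fromRel_adj, mem_filter, mem_univ, true_and, mem_image,
      hammingDist_comm u v, or_self]
    constructor
    · rintro ⟨-, h⟩
      obtain ⟨i, hi⟩ := card_eq_one.1 h
      refine ⟨i, funext fun j => ?_⟩
      have hj := Finset.ext_iff.1 hi j
      simp only [mem_filter, mem_univ, true_and, mem_singleton] at hj
      by_cases hij : j = i
      · subst hij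
        have := hj.2 rfl
        rw [Function.update_self]
        cases hv : v j <;> cases hu : u j <;> simp_all
      · rw [Function.update_of_ne hij]
        by_contra hne
        exact hij (hj.1 hne)
    · rintro ⟨i, rfl⟩
      refine ⟨fun h => ?_, ?_⟩
      · have := congrFun h i
        simp at this
      · refine card_eq_one.2 ⟨i, ?_⟩
        ext j
        by_cases hij : j = i
        · subst hij; simp
        · simp [hij]
  rw [h, card_image_of_injective, card_univ, Fintype.card_fin]
  intro i j hij
  by_contra hne
  have := congrFun hij i
  simp [Function.update_of_ne hne] at this

lemma prob_eq_one_sub {Ω : Type*} [Fintype Ω] [Nonempty Ω] (p : Ω → Prop) :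
    prob p = 1 - ((Finset.univ.filter fun ω => ¬ p ω).card : ℝ) / Fintype.card Ω := by
  have hΩ : (Fintype.card Ω : ℝ) ≠ 0 := by exact_mod_cast Fintype.card_ne_zero
  have h : ((Finset.univ.filter p).card : ℝ) + (Finset.univ.filter fun ω => ¬ p ω).card =
      Fintype.card Ω := by
    exact_mod_cast Finset.card_filter_add_card_filter_not (s := Finset.univ) p
  rw [prob, Nat.card_eq_fintype_card, Nat.card_eq_fintype_card, Fintype.card_subtype,
    eq_sub_iff_add_eq, ← add_div, h, div_self hΩ]

section Regular

open Finset

variable {V : Type*} [Fintype V] (G : SimpleGraph V)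

/-- The possible choices of one neighbour of `v`. -/
abbrev NbrChoice (v : V) := {s : Finset V // s.card = 1 ∧ ∀ u ∈ s, G.Adj v u}

lemma card_nbrChoice (v : V) : Fintype.card (NbrChoice G v) = #{u | G.Adj v u} := by
  rw [← Fintype.card_subtype]
  symm
  refine Fintype.card_of_bijective
    (f := fun u : {u // G.Adj v u} => (⟨{u.1}, by simp, by simpa using u.2⟩ : NbrChoice G v))
    ⟨fun a b h => ?_, fun s => ?_⟩
  · simpa [Subtype.ext_iff] using h
  · obtain ⟨u, hu⟩ := card_eq_one.1 s.2.1
    refine ⟨⟨u, s.2.2 u (by simp [hu])⟩, Subtype.ext hu.symm⟩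

/-- Self-avoiding walks with `m` edges. -/
def selfAvoidingWalks (m : ℕ) : Finset (Fin (m + 1) → V) :=
  {x | Function.Injective x ∧ ∀ i : Fin m, G.Adj (x i.castSucc) (x i.succ)}

variable {G}

lemma tail_mem_selfAvoidingWalks {m : ℕ} {x : Fin (m + 2) → V}
    (hx : x ∈ selfAvoidingWalks G (m + 1)) : Fin.tail x ∈ selfAvoidingWalks G m := by
  simp only [selfAvoidingWalks, mem_filter, mem_univ, true_and] at hx ⊢
  exact ⟨hx.1.comp (Fin.succ_injective _), fun i => hx.2 i.succ⟩

lemma card_fiber_tail_le {m : ℕ} (y : Fin (m + 1) → V) (s : Finset V)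
    (hs : ∀ x ∈ selfAvoidingWalks G (m + 1), Fin.tail x = y → x 0 ∈ s) :
    #{x ∈ selfAvoidingWalks G (m + 1) | Fin.tail x = y} ≤ #s := by
  refine card_le_card_of_injOn (fun x => x 0) ?_ ?_
  · intro x hx
    simp only [coe_filter, Set.mem_ofPred_eq] at hx
    exact hs x hx.1 hx.2
  · intro x hx z hz h
    simp only [coe_filter, Set.mem_ofPred_eq] at hx hz h
    rw [← Fin.cons_self_tail x, ← Fin.cons_self_tail z, hx.2, hz.2, h]

variable {d : ℕ} (hG : ∀ v, #{u | G.Adj v u} = d)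
include hG

lemma card_selfAvoidingWalks_succ_le (m : ℕ) :
    #(selfAvoidingWalks G (m + 1)) ≤ d * (d - 1) ^ m * Fintype.card V := by
  induction m with
  | zero =>
    have h0 : #(selfAvoidingWalks G 0) ≤ Fintype.card V := by
      refine (card_le_univ _).trans ?_
      simp
    refine (card_le_mul_card_image_of_maps_to
      (fun x hx => tail_mem_selfAvoidingWalks hx) d fun y _ => ?_).trans ?_
    · rw [← hG (y 0)]
      refine card_fiber_tail_le y _ fun x hx hxy => ?_
      simp only [selfAvoidingWalks, mem_filter, mem_univ, true_and] at hx ⊢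
      subst hxy
      exact (hx.2 0).symm
    · simpa using Nat.mul_le_mul_left d h0
  | succ m ih =>
    refine (card_le_mul_card_image_of_maps_to
      (fun x hx => tail_mem_selfAvoidingWalks hx) (d - 1) fun y hy => ?_).trans
      ((Nat.mul_le_mul_left _ ih).trans (le_of_eq (by ring)))
    have hy1 : y 1 ∈ ({u | G.Adj (y 0) u} : Finset V) := by
      simp only [selfAvoidingWalks, mem_filter, mem_univ, true_and] at hy ⊢
      exact hy.2 0
    rw [← hG (y 0), ← card_erase_of_mem hy1]
    refine card_fiber_tail_le y _ fun x hx hxy => ?_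
    simp only [selfAvoidingWalks, mem_filter, mem_univ, true_and, mem_erase] at hx ⊢
    subst hxy
    refine ⟨fun h => ?_, (hx.2 0).symm⟩
    have := congrArg Fin.val (hx.1 h)
    simp only [Fin.val_zero, Fin.val_succ] at this
    omega

/-- Prescribing the choices at `m` distinct vertices has probability at most `d⁻ᵐ`. -/
lemma card_prescribed_mul_le {m : ℕ} (s t : Fin m → V) (hs : Function.Injective s) :
    #{ω : ∀ v, NbrChoice G v | ∀ i, t i ∈ (ω (s i)).1} * d ^ m ≤ d ^ Fintype.card V := by
  have h1 : ({ω : ∀ v, NbrChoice G v | ∀ i, t i ∈ (ω (s i)).1} : Finset _) =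
      Fintype.piFinset fun v => {c : NbrChoice G v | ∀ i, s i = v → t i ∈ c.1} := by
    ext ω
    simp only [mem_filter, mem_univ, true_and, Fintype.mem_piFinset]
    exact ⟨fun h v i hi => hi ▸ h i, fun h i => h _ i rfl⟩
  have h2 : d ^ m = ∏ v : V, if v ∈ univ.image s then d else 1 := by
    rw [prod_ite_mem, univ_inter, prod_const, card_image_of_injective _ hs, card_univ,
      Fintype.card_fin]
  have h3 : d ^ Fintype.card V = ∏ _v : V, d := by rw [prod_const, card_univ]
  rw [h1, Fintype.card_piFinset, h2, h3, ← prod_mul_distrib]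
  refine prod_le_prod' fun v _ => ?_
  split_ifs with h
  · obtain ⟨i, -, hi⟩ := mem_image.1 h
    suffices #{c : NbrChoice G v | ∀ i, s i = v → t i ∈ c.1} ≤ 1 by
      simpa using Nat.mul_le_mul_right d this
    refine card_le_one.2 fun a ha b hb => Subtype.ext ?_
    simp only [mem_filter, mem_univ, true_and] at ha hb
    obtain ⟨x, hx⟩ := card_eq_one.1 a.2.1
    obtain ⟨y, hy⟩ := card_eq_one.1 b.2.1
    have h1 := ha i hi
    have h2 := hb i hi
    rw [hx, mem_singleton] at h1
    rw [hy, mem_singleton] at h2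
    rw [hx, hy, ← h1, ← h2]
  · rw [mul_one, ← hG v, ← card_nbrChoice]
    exact card_le_univ _

omit hG

/-- The graph formed by all the chosen edges. -/
abbrev choiceGraph (ω : ∀ v, NbrChoice G v) : SimpleGraph V :=
  SimpleGraph.fromRel (fun u v => v ∈ (ω u).1)

/-- The endpoint of the `i`-th edge of a walk which is nearer to the `l`-th vertex. -/
def nearEnd {m : ℕ} (l : Fin (m + 1)) (i : Fin m) : Fin (m + 1) :=
  if i.castSucc < l then i.succ else i.castSucc

/-- Self-avoiding walks all of whose edges are chosen by the endpoint away from the `l`-th vertex. -/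
def walksToward (ω : ∀ v, NbrChoice G v) (m : ℕ) (l : Fin (m + 1)) : Finset (Fin (m + 1) → V) :=
  {x ∈ selfAvoidingWalks G m | ∀ i, x (nearEnd l i) ∈ (ω (x (l.succAbove i))).1}

/-- Ordered pairs of vertices in the same component. -/
def connectedPairs (H : SimpleGraph V) : Finset (V × V) := {q | H.Reachable q.1 q.2}

lemma mem_connectedPairs {H : SimpleGraph V} {q : V × V} :
    q ∈ connectedPairs H ↔ H.Reachable q.1 q.2 := by
  simp [connectedPairs]

/-- Along a path, the edges are all chosen by the endpoint away from some vertex of the path. -/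
lemma exists_selfAvoidingWalk_of_reachable (ω : ∀ v, NbrChoice G v) {u v : V}
    (h : (choiceGraph ω).Reachable u v) :
    ∃ m < Fintype.card V, ∃ l : Fin (m + 1), ∃ x ∈ walksToward ω m l, (x 0, x (Fin.last m)) = (u, v) := by
  obtain ⟨p, hp⟩ := h.exists_isPath
  have huniq : ∀ {a b c : V}, b ∈ (ω a).1 → c ∈ (ω a).1 → b = c := fun {a b c} hb hc =>
    card_le_one.1 (ω a).2.1.le b hb c hc
  have hadj : ∀ i < p.length, p.getVert (i + 1) ∈ (ω (p.getVert i)).1 ∨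
      p.getVert i ∈ (ω (p.getVert (i + 1))).1 := fun i hi =>
    ((SimpleGraph.fromRel_adj _ _ _).1 (p.adj_getVert_succ hi)).2
  have hex : ∃ l, l = p.length ∨ p.getVert (l + 1) ∉ (ω (p.getVert l)).1 := ⟨_, Or.inl rfl⟩
  have hl : Nat.find hex ≤ p.length := Nat.find_min' hex (Or.inl rfl)
  have hfwd : ∀ i < Nat.find hex, p.getVert (i + 1) ∈ (ω (p.getVert i)).1 := fun i hi => by
    have := Nat.find_min hex hi
    push Not at this
    exact this.2
  have hbwd : ∀ i, Nat.find hex ≤ i → i < p.length →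
      p.getVert i ∈ (ω (p.getVert (i + 1))).1 := by
    intro i hi
    induction i, hi using Nat.le_induction with
    | base =>
      intro hlt
      exact (hadj _ hlt).resolve_left ((Nat.find_spec hex).resolve_left hlt.ne)
    | succ i hi ih =>
      intro hlt
      refine (hadj _ hlt).resolve_left fun h => ?_
      have := hp.getVert_injOn (by simp; omega) (by simp; omega)
        (huniq (ih (by omega)) h)
      omega
  refine ⟨p.length, hp.length_lt, ⟨Nat.find hex, by omega⟩, fun i => p.getVert i,
    mem_filter.2 ⟨?_, ?_⟩, ?_⟩
  · simp only [selfAvoidingWalks, mem_filter, mem_univ, true_and]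
    refine ⟨fun i j hij => Fin.ext (hp.getVert_injOn (by simp; omega) (by simp; omega) hij),
      fun i => ?_⟩
    rcases hadj i i.2 with h | h
    · exact (ω _).2.2 _ h
    · exact ((ω _).2.2 _ h).symm
  · intro i
    rcases lt_or_ge (i : ℕ) (Nat.find hex) with hi | hi
    · have hi' : i.castSucc < (⟨Nat.find hex, by omega⟩ : Fin (p.length + 1)) := hi
      rw [Fin.succAbove_of_castSucc_lt _ _ hi', nearEnd, if_pos hi']
      exact hfwd i hi
    · have hi' : (⟨Nat.find hex, by omega⟩ : Fin (p.length + 1)) ≤ i.castSucc := hi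
      rw [Fin.succAbove_of_le_castSucc _ _ hi', nearEnd, if_neg hi'.not_gt]
      exact hbwd i hi i.2
  · simp

lemma card_connectedPairs_le (ω : ∀ v, NbrChoice G v) :
    #(connectedPairs (choiceGraph ω)) ≤
      ∑ m ∈ range (Fintype.card V), ∑ l : Fin (m + 1), #(walksToward ω m l) := by
  have hsub : connectedPairs (choiceGraph ω) ⊆
      (range (Fintype.card V)).biUnion fun m => (univ : Finset (Fin (m + 1))).biUnion fun l =>
        (walksToward ω m l).image fun x => (x 0, x (Fin.last m)) := by
    rintro ⟨u, v⟩ hq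
    obtain ⟨m, hm, l, x, hx, hxe⟩ :=
      exists_selfAvoidingWalk_of_reachable ω (mem_connectedPairs.1 hq)
    simp only [mem_biUnion, mem_image, mem_range, mem_univ, true_and]
    exact ⟨m, hm, l, x, hx, hxe⟩
  refine (card_le_card hsub).trans (card_biUnion_le.trans (sum_le_sum fun m _ => ?_))
  exact card_biUnion_le.trans (sum_le_sum fun l _ => card_image_le)

lemma sum_succ_mul_geom_le {d : ℝ} (hd : 1 ≤ d) (M : ℕ) :
    ∑ m ∈ range M, ((m : ℝ) + 1) * (1 - 1 / d) ^ m ≤ d ^ 2 := by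
  have hd0 : d ≠ 0 := by positivity
  have h : ∑ m ∈ range M, ((m : ℝ) + 1) * (1 - 1 / d) ^ m =
      d ^ 2 * (1 - (1 - 1 / d) ^ M * (1 + M / d)) := by
    induction M with
    | zero => simp
    | succ M ih =>
      rw [sum_range_succ, ih, pow_succ (1 - 1 / d) M]
      push_cast
      generalize (1 - 1 / d) ^ M = r
      field_simp
      ring
  have hr : 0 ≤ 1 - 1 / d := by
    rw [sub_nonneg, div_le_one (by positivity)]
    exact hd
  rw [h]
  refine mul_le_of_le_one_right (by positivity) (sub_le_self _ ?_)
  positivity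

include hG

lemma sum_card_walksToward_mul_le {m : ℕ} (l : Fin (m + 1)) :
    (∑ ω : ∀ v, NbrChoice G v, #(walksToward ω m l)) * d ^ m ≤
      #(selfAvoidingWalks G m) * d ^ Fintype.card V := by
  simp_rw [walksToward, card_filter]
  rw [sum_comm, sum_mul, ← smul_eq_mul, ← sum_const]
  refine sum_le_sum fun x hx => ?_
  rw [← card_filter]
  refine card_prescribed_mul_le hG _ _ ?_
  exact (mem_filter.1 hx).2.1.comp Fin.succAbove_right_injective

/-- The expected number of connected ordered pairs is at most `3d²|V|`. -/
lemma sum_card_connectedPairs_le (hd : 1 ≤ d) :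
    (∑ ω : ∀ v, NbrChoice G v, (#(connectedPairs (choiceGraph ω)) : ℝ)) ≤
      3 * (d : ℝ) ^ 2 * Fintype.card V * (d : ℝ) ^ Fintype.card V := by
  set N := Fintype.card V with hN
  have hd' : (1 : ℝ) ≤ d := by exact_mod_cast hd
  have hd0 : (0 : ℝ) < d := by linarith
  have hr : 0 ≤ 1 - 1 / (d : ℝ) := by
    rw [sub_nonneg, div_le_one hd0]
    exact hd'
  have hwalk : ∀ m, (#(selfAvoidingWalks G (m + 1)) : ℝ) / (d : ℝ) ^ (m + 1) ≤
      N * (1 - 1 / (d : ℝ)) ^ m := by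
    intro m
    have h : (#(selfAvoidingWalks G (m + 1)) : ℝ) ≤ d * ((d : ℝ) - 1) ^ m * N := by
      have := card_selfAvoidingWalks_succ_le hG m
      rw [← Nat.cast_pred hd]
      exact_mod_cast this
    rw [div_le_iff₀ (by positivity)]
    refine h.trans (le_of_eq ?_)
    rw [one_sub_div hd0.ne', div_pow]
    field_simp
    ring
  have hwalk0 : (#(selfAvoidingWalks G 0) : ℝ) / (d : ℝ) ^ 0 ≤ N := by
    rw [pow_zero, div_one]
    have : #(selfAvoidingWalks G 0) ≤ N := (card_le_univ _).trans (by simp [hN])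
    exact_mod_cast this
  have hpair : ∀ ω : ∀ v, NbrChoice G v,
      (#(connectedPairs (choiceGraph ω)) : ℝ) ≤
      ∑ m ∈ range (N + 1), ∑ l : Fin (m + 1), (#(walksToward ω m l) : ℝ) := by
    intro ω
    have h := (card_connectedPairs_le ω).trans
      (sum_le_sum_of_subset (range_subset_range.2 N.le_succ))
    exact_mod_cast h
  have hbound : ∀ m, ∑ ω : ∀ v, NbrChoice G v, ∑ l : Fin (m + 1),
      (#(walksToward ω m l) : ℝ) ≤
      (d : ℝ) ^ N * ((m + 1) * (#(selfAvoidingWalks G m) / (d : ℝ) ^ m)) := by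
    intro m
    rw [sum_comm]
    have : ∀ l ∈ (univ : Finset (Fin (m + 1))), ∑ ω : ∀ v, NbrChoice G v,
        (#(walksToward ω m l) : ℝ) ≤
        #(selfAvoidingWalks G m) * (d : ℝ) ^ N / (d : ℝ) ^ m := by
      intro l _
      rw [le_div_iff₀ (by positivity)]
      exact_mod_cast sum_card_walksToward_mul_le hG l
    refine (sum_le_card_nsmul _ _ _ this).trans (le_of_eq ?_)
    rw [card_univ, Fintype.card_fin, nsmul_eq_mul]
    push_cast
    ring
  calc (∑ ω : ∀ v, NbrChoice G v, (#(connectedPairs (choiceGraph ω)) : ℝ))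
      ≤ ∑ m ∈ range (N + 1), (d : ℝ) ^ N *
          ((m + 1) * (#(selfAvoidingWalks G m) / (d : ℝ) ^ m)) := by
        refine (sum_le_sum fun ω _ => hpair ω).trans ?_
        rw [sum_comm]
        exact sum_le_sum fun m _ => hbound m
    _ ≤ (d : ℝ) ^ N * (N * (2 * ∑ m ∈ range N, ((m : ℝ) + 1) * (1 - 1 / (d : ℝ)) ^ m) + N) := by
        rw [← mul_sum]
        refine mul_le_mul_of_nonneg_left ?_ (by positivity)
        rw [sum_range_succ', mul_sum, mul_sum]
        refine add_le_add (sum_le_sum fun m _ => ?_) (by simpa using hwalk0)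
        refine (mul_le_mul_of_nonneg_left (hwalk m) (by positivity)).trans ?_
        have h0 : (0 : ℝ) ≤ N * (1 - 1 / (d : ℝ)) ^ m := by positivity
        have hm : (0 : ℝ) ≤ m := by positivity
        push_cast
        nlinarith [mul_nonneg hm h0]
    _ ≤ (d : ℝ) ^ N * (N * (2 * (d : ℝ) ^ 2) + N * (d : ℝ) ^ 2) := by
        gcongr
        · exact sum_succ_mul_geom_le hd' N
        · exact le_mul_of_one_le_right (by positivity) (one_le_pow₀ hd')
    _ = 3 * (d : ℝ) ^ 2 * N * (d : ℝ) ^ N := by ring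

omit hG

lemma compSize_sq_le_card_connectedPairs (H : SimpleGraph V) (v : V) :
    compSize H v ^ 2 ≤ #(connectedPairs H) := by
  have h : compSize H v = #{w | H.Reachable v w} := by
    rw [compSize, Nat.card_eq_fintype_card, Fintype.card_subtype]
  rw [h, sq, ← card_product]
  refine card_le_card fun q hq => ?_
  simp only [mem_connectedPairs, mem_product, mem_filter, mem_univ, true_and] at hq ⊢
  exact hq.1.symm.trans hq.2

include hG

/-- Markov's inequality for the number of connected ordered pairs. -/
lemma card_large_component_mul_le (hd : 1 ≤ d) {T : ℝ} (hT : 0 ≤ T) :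
    (#{ω : ∀ v, NbrChoice G v | ¬ ∀ v, (compSize (choiceGraph ω) v : ℝ) ≤ T} : ℝ) * T ^ 2 ≤
      3 * (d : ℝ) ^ 2 * Fintype.card V * (d : ℝ) ^ Fintype.card V := by
  refine le_trans ?_ (sum_card_connectedPairs_le hG hd)
  rw [← nsmul_eq_mul]
  refine (card_nsmul_le_sum _ (fun ω : ∀ v, NbrChoice G v =>
    (#(connectedPairs (choiceGraph ω)) : ℝ)) _ fun ω hω => ?_).trans
    (sum_le_sum_of_subset_of_nonneg (subset_univ _) fun _ _ _ => by positivity)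
  obtain ⟨v, hv⟩ := not_forall.1 (mem_filter.1 hω).2
  refine (pow_le_pow_left₀ hT (not_le.1 hv).le 2).trans ?_
  exact_mod_cast compSize_sq_le_card_connectedPairs (choiceGraph ω) v

lemma one_sub_le_prob_compSize_le (hd : 1 ≤ d) {T : ℝ} (hT : 0 < T) :
    1 - 3 * (d : ℝ) ^ 2 * Fintype.card V / T ^ 2 ≤
      prob fun ω : ∀ v, NbrChoice G v => ∀ v, (compSize (choiceGraph ω) v : ℝ) ≤ T := by
  have hcard : Fintype.card (∀ v, NbrChoice G v) = d ^ Fintype.card V := by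
    rw [Fintype.card_pi, prod_congr rfl fun v _ => (card_nbrChoice G v).trans (hG v), prod_const,
      card_univ]
  have : Nonempty (∀ v, NbrChoice G v) := Fintype.card_pos_iff.1 (hcard ▸ by positivity)
  rw [prob_eq_one_sub, hcard, Nat.cast_pow]
  refine sub_le_sub_left ?_ 1
  rw [div_le_div_iff₀ (by positivity) (by positivity)]
  refine le_of_eq_of_le ?_ (card_large_component_mul_le hG hd hT.le)
  congr!

end Regular

lemma one_sub_le_prob_kOut_compSize_le {n : ℕ} (hn : 1 ≤ n) :
    1 - 3 / (n : ℝ) ≤ prob (fun ω : KOut n 1 => ∀ v : Vtx n,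
      (compSize (kOutGraph n 1 ω) v : ℝ) ≤ (n : ℝ) ^ 3 * (2 : ℝ) ^ ((n : ℝ) / 2)) := by
  have hn' : (1 : ℝ) ≤ n := by exact_mod_cast hn
  have hT : ((n : ℝ) ^ 3 * (2 : ℝ) ^ ((n : ℝ) / 2)) ^ 2 = (n : ℝ) ^ 6 * 2 ^ n := by
    rw [mul_pow, ← pow_mul, ← Real.rpow_natCast ((2 : ℝ) ^ ((n : ℝ) / 2)),
      ← Real.rpow_mul (by norm_num)]
    norm_num
  have hV : (Fintype.card (Vtx n) : ℝ) = 2 ^ n := by simp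
  have h := one_sub_le_prob_compSize_le (card_filter_cubeGraph_adj n) hn
    (T := (n : ℝ) ^ 3 * (2 : ℝ) ^ ((n : ℝ) / 2)) (by positivity)
  refine le_trans (sub_le_sub_left ?_ 1) h
  rw [hT, hV, mul_div_mul_right _ _ (by positivity), div_le_div_iff₀ (by positivity) (by positivity),
    mul_assoc, ← pow_succ]
  gcongr
  norm_num

/-- W.h.p. every connected component of `Q^n(1)` has at most `n³·2^{n/2}` vertices. -/
theorem stmt_1 :
    Tendsto (fun n : ℕ =>
        prob (fun ω : KOut n 1 =>
          ∀ v : Vtx n,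
            (compSize (kOutGraph n 1 ω) v : ℝ) ≤ (n : ℝ) ^ 3 * (2 : ℝ) ^ ((n : ℝ) / 2)))
      atTop (nhds 1) := by
  have hlim : Tendsto (fun n : ℕ => 1 - 3 / (n : ℝ)) atTop (nhds 1) := by
    simpa using tendsto_const_nhds.sub (tendsto_const_div_atTop_nhds_zero_nat (3 : ℝ))
  refine tendsto_of_tendsto_of_tendsto_of_le_of_le' hlim tendsto_const_nhds ?_ ?_
  · filter_upwards [eventually_ge_atTop 1] with n hn
    exact one_sub_le_prob_kOut_compSize_le hn
  · refine Eventually.of_forall fun n => div_le_one_of_le₀ ?_ (Nat.cast_nonneg _)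
    exact_mod_cast Finite.card_subtype_le _
end
end
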